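/- Fix s ∈ [0,1] with s ≠ 1/2. Let Φ be a unital completely positive map on M_N(ℂ), self-adjoint with respect to ⟨B,A⟩_{δ_s} = Tr[B* σ^s A σ^{1−s}], of the form Φ(A) = Σ_{j=1}^d Σ_{k=1}^{M_j} ( μ_j^{1/2} V_k^{(j)*} A V_k^{(j)} + μ_j^{−1/2} V_k^{(j)} A V_k^{(j)*} ), where μ_1 < … < μ_d with each μ_j > 1, σ V_k^{(j)} σ^{−1} = μ_j V_k^{(j)}, and the family { V_k^{(j)} } is linearly independent. Define X^{(j)}_{k,ℓ} = μ_j^{1/2} V_k^{(j)*} V_ℓ^{(j)} + μ_j^{−1/2} V_ℓ^{(j)} V_k^{(j)*}. Then Φ is an extreme point of the convex set of unital completely positive maps that are self-adjoint with respect to ⟨·,·⟩_{δ_s} if and only if the family { X^{(j)}_{k,ℓ} : 1 ≤ k,ℓ ≤ M_j, 1 ≤ j ≤ d } is linearly independent. -/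

import Mathlib

open MeasureTheory Matrix
open scoped ComplexOrder

noncomputable section

/-- The algebra of `N × N` complex matrices. -/
abbrev Mat (N : ℕ) := Matrix (Fin N) (Fin N) ℂ

variable {N : ℕ}

/-- Real power `σ^s` of a positive definite matrix, defined via the spectral decomposition. -/
noncomputable def mpow (σ : Mat N) (hσ : σ.PosDef) (s : ℝ) : Mat N :=
  (hσ.1.eigenvectorUnitary : Mat N) *
    Matrix.diagonal (fun i => ((hσ.1.eigenvalues i ^ s : ℝ) : ℂ)) *
    star (hσ.1.eigenvectorUnitary : Mat N)

/-- Complete positivity of a linear map on `M_N(ℂ)`: existence of a Kraus representation. -/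
def IsCP (Φ : Mat N →ₗ[ℂ] Mat N) : Prop :=
  ∃ (M : ℕ) (V : Fin M → Mat N), ∀ A, Φ A = ∑ j, (V j)ᴴ * A * V j

/-- The KMS inner product `⟨B,A⟩_KMS = Tr[Bᴴ σ^{1/2} A σ^{1/2}]`. -/
def kmsInner (σ : Mat N) (hσ : σ.PosDef) (B A : Mat N) : ℂ :=
  (Bᴴ * mpow σ hσ (1/2) * A * mpow σ hσ (1/2)).trace

/-- Self-adjointness with respect to the KMS inner product. -/
def IsKMSSelfAdjoint (σ : Mat N) (hσ : σ.PosDef) (Φ : Mat N →ₗ[ℂ] Mat N) : Prop :=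
  ∀ A B, kmsInner σ hσ B (Φ A) = kmsInner σ hσ (Φ B) A

/-- The inner product `⟨B,A⟩_{δ_s} = Tr[Bᴴ σ^s A σ^{1-s}]`. -/
def dsInner (σ : Mat N) (hσ : σ.PosDef) (s : ℝ) (B A : Mat N) : ℂ :=
  (Bᴴ * mpow σ hσ s * A * mpow σ hσ (1 - s)).trace

/-- Self-adjointness with respect to `⟨·,·⟩_{δ_s}`. -/
def IsDsSelfAdjoint (σ : Mat N) (hσ : σ.PosDef) (s : ℝ) (Φ : Mat N →ₗ[ℂ] Mat N) : Prop :=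
  ∀ A B, dsInner σ hσ s B (Φ A) = dsInner σ hσ s (Φ B) A

set_option linter.unusedSectionVars false
set_option linter.unusedSimpArgs false

def TT {ι : Type*} [Fintype ι] (W : ι → Mat N) (c : Matrix ι ι ℂ) : Mat N →ₗ[ℂ] Mat N :=
  ∑ a, ∑ b, c a b • (LinearMap.mulRight ℂ (W b) ∘ₗ LinearMap.mulLeft ℂ (W a)ᴴ)

lemma TT_apply {ι : Type*} [Fintype ι] (W : ι → Mat N) (c : Matrix ι ι ℂ) (A : Mat N) :
    TT W c A = ∑ a, ∑ b, c a b • ((W a)ᴴ * A * W b) := by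
  simp [TT, LinearMap.sum_apply]

lemma TT_add {ι : Type*} [Fintype ι] (W : ι → Mat N) (c c' : Matrix ι ι ℂ) :
    TT W (c + c') = TT W c + TT W c' := by
  simp [TT, add_smul, Finset.sum_add_distrib]

lemma TT_smul {ι : Type*} [Fintype ι] (W : ι → Mat N) (z : ℂ) (c : Matrix ι ι ℂ) :
    TT W (z • c) = z • TT W c := by
  simp [TT, mul_smul, Finset.smul_sum]

lemma TT_sub {ι : Type*} [Fintype ι] (W : ι → Mat N) (c c' : Matrix ι ι ℂ) :
    TT W (c - c') = TT W c - TT W c' := by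
  rw [sub_eq_add_neg, ← neg_one_smul ℂ c', TT_add, TT_smul, neg_one_smul ℂ (TT W c'), sub_eq_add_neg]

lemma TT_entry {ι : Type*} [Fintype ι] (W : ι → Mat N) (c : Matrix ι ι ℂ) (p q i j : Fin N) :
    TT W c (Matrix.single p q 1) i j = ∑ a, ∑ b, c a b * (star (W a p i) * W b q j) := by
  rw [TT_apply]
  simp only [Matrix.sum_apply, Matrix.smul_apply, smul_eq_mul]
  refine Finset.sum_congr rfl fun a _ => Finset.sum_congr rfl fun b _ => ?_
  congr 1
  rw [Matrix.mul_apply, Finset.sum_eq_single q]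
  · simp [Matrix.mul_apply, Matrix.single_apply]
  · intro k _ hk
    simp [Matrix.mul_apply, Matrix.single_apply, hk.symm]
  · simp

lemma TT_inj0 {ι : Type*} [Fintype ι] (W : ι → Mat N) (hW : LinearIndependent ℂ W)
    (c : Matrix ι ι ℂ) (h : TT W c = 0) : c = 0 := by
  rw [Fintype.linearIndependent_iff] at hW
  have h1 : ∀ p i b, ∑ a, c a b * star (W a p i) = 0 := by
    intro p i
    apply hW
    ext q j
    have := TT_entry W c p q i j
    rw [h, Finset.sum_comm] at this
    simp only [LinearMap.zero_apply, Matrix.zero_apply] at this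
    simp only [Matrix.sum_apply, Matrix.smul_apply, smul_eq_mul, Matrix.zero_apply, Finset.sum_mul]
    rw [this]
    exact Finset.sum_congr rfl fun a _ => Finset.sum_congr rfl fun b _ => by ring
  ext a b
  have h2 := hW (fun a => star (c a b)) (by
    ext p i
    have := congrArg star (h1 p i b)
    simp only [star_sum, star_mul', star_star, star_zero] at this
    simpa [Matrix.sum_apply] using this) a
  simpa using h2

lemma TT_inj {ι : Type*} [Fintype ι] (W : ι → Mat N) (hW : LinearIndependent ℂ W)
    (c c' : Matrix ι ι ℂ) (h : TT W c = TT W c') : c = c' := by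
  have := TT_inj0 W hW (c - c') (by rw [TT_sub, h, sub_self])
  exact sub_eq_zero.mp this

lemma isCP_of_fintype {κ : Type*} [Fintype κ] (Φ : Mat N →ₗ[ℂ] Mat N) (K : κ → Mat N)
    (h : ∀ A, Φ A = ∑ j, (K j)ᴴ * A * K j) : IsCP Φ := by
  refine ⟨Fintype.card κ, fun j => K ((Fintype.equivFin κ).symm j), fun A => ?_⟩
  rw [h, ← (Fintype.equivFin κ).symm.sum_comp]

lemma TT_gram {ι κ : Type*} [Fintype ι] [Fintype κ] (W : ι → Mat N) (B : Matrix κ ι ℂ)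
    (A : Mat N) : TT W (Bᴴ * B) A =
      ∑ m, (∑ a, B m a • W a)ᴴ * A * (∑ a, B m a • W a) := by
  rw [TT_apply]
  simp only [Matrix.mul_apply, Matrix.conjTranspose_apply, Matrix.conjTranspose_sum,
    Matrix.conjTranspose_smul, Finset.sum_mul, Finset.mul_sum, Finset.sum_smul]
  rw [Finset.sum_comm' (t' := Finset.univ) (s' := fun _ => Finset.univ) (by simp)]
  rw [Finset.sum_comm]
  conv_lhs => enter [2, a]; rw [Finset.sum_comm]
  rw [Finset.sum_comm]
  conv_lhs => enter [2, m]; rw [Finset.sum_comm]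
  refine Finset.sum_congr rfl fun m _ => Finset.sum_congr rfl fun a _ =>
    Finset.sum_congr rfl fun b _ => ?_
  simp only [Matrix.smul_mul, Matrix.mul_smul, smul_smul, mul_comm]

open scoped MatrixOrder Matrix.Norms.L2Operator in
lemma TT_cp {ι : Type*} [Fintype ι] [DecidableEq ι] (W : ι → Mat N) (c : Matrix ι ι ℂ)
    (hc : c.PosSemidef) : IsCP (TT W c) := by
  obtain ⟨B, rfl⟩ := (CStarAlgebra.nonneg_iff_eq_star_mul_self (a := c)).mp hc.nonneg
  exact isCP_of_fintype _ _ (TT_gram W B)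

/-- quadratic functional detecting the Kraus span -/
def QQ (Y : Mat N) (Φ : Mat N →ₗ[ℂ] Mat N) : ℂ :=
  ∑ p, ∑ i, ∑ q, ∑ j, star (Y p i) * Y q j * Φ (Matrix.single p q 1) i j

lemma QQ_kraus {κ : Type*} [Fintype κ] (Y : Mat N) (Φ : Mat N →ₗ[ℂ] Mat N) (K : κ → Mat N)
    (h : ∀ A, Φ A = ∑ j, (K j)ᴴ * A * K j) :
    QQ Y Φ = ((∑ m, ‖∑ p, ∑ i, Y p i * K m p i‖ ^ 2 : ℝ) : ℂ) := by
  classical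
  have hT : Φ = TT K 1 := by
    ext1 A
    rw [h, TT_apply]
    simp [Matrix.one_apply]
  have he : ∀ p q i j, Φ (Matrix.single p q 1) i j = ∑ m, star (K m p i) * K m q j := by
    intro p q i j
    rw [hT, TT_entry]
    simp [Matrix.one_apply]
  have hn : ∀ z : ℂ, ((‖z‖ ^ 2 : ℝ) : ℂ) = star z * z := by
    intro z
    have := Complex.conj_mul' z
    push_cast
    exact this.symm
  rw [Complex.ofReal_sum]
  simp only [hn, QQ, he, star_sum, Finset.sum_mul, Finset.mul_sum]
  have e1 : ∀ f : Fin N → Fin N → Fin N → Fin N → κ → ℂ,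
      ∑ p, ∑ i, ∑ q, ∑ j, ∑ m, f p i q j m = ∑ m, ∑ p, ∑ i, ∑ q, ∑ j, f p i q j m := by
    intro f
    calc _ = ∑ p, ∑ i, ∑ q, ∑ m, ∑ j, f p i q j m := by
            simp_rw [Finset.sum_comm (s := Finset.univ (α := Fin N)) (t := Finset.univ (α := κ))]
      _ = _ := by
        conv_lhs => enter [2, p, 2, i]; rw [Finset.sum_comm]
        conv_lhs => enter [2, p]; rw [Finset.sum_comm]
        rw [Finset.sum_comm]
  rw [e1]
  refine Finset.sum_congr rfl fun m _ => ?_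
  have e2 : ∀ f : Fin N → Fin N → Fin N → Fin N → ℂ,
      ∑ p, ∑ i, ∑ q, ∑ j, f p i q j = ∑ q, ∑ j, ∑ p, ∑ i, f p i q j := by
    intro f
    conv_lhs => enter [2, p]; rw [Finset.sum_comm]
    rw [Finset.sum_comm]
    refine Finset.sum_congr rfl fun q _ => ?_
    conv_lhs => enter [2, p]; rw [Finset.sum_comm]
    rw [Finset.sum_comm]
  rw [e2]
  refine Finset.sum_congr rfl fun p _ => Finset.sum_congr rfl fun i _ =>
    Finset.sum_congr rfl fun q _ => Finset.sum_congr rfl fun j _ => ?_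
  simp only [star_mul']
  ring

lemma kraus_span {κ κ₁ κ₂ : Type*} [Fintype κ] [Fintype κ₁] [Fintype κ₂]
    (Φ Ψ₁ Ψ₂ : Mat N →ₗ[ℂ] Mat N) (K : κ → Mat N) (K₁ : κ₁ → Mat N) (K₂ : κ₂ → Mat N)
    (h : ∀ A, Φ A = ∑ j, (K j)ᴴ * A * K j)
    (h₁ : ∀ A, Ψ₁ A = ∑ j, (K₁ j)ᴴ * A * K₁ j)
    (h₂ : ∀ A, Ψ₂ A = ∑ j, (K₂ j)ᴴ * A * K₂ j)
    (t : ℝ) (ht : 0 < t) (ht1 : t < 1)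
    (he : Φ = (t : ℂ) • Ψ₁ + ((1 - t : ℝ) : ℂ) • Ψ₂) (m : κ₁) :
    K₁ m ∈ Submodule.span ℂ (Set.range K) := by
  rw [← Subspace.forall_mem_dualAnnihilator_apply_eq_zero_iff]
  intro f hf
  rw [Submodule.mem_dualAnnihilator] at hf
  set Y : Mat N := fun p i => f (Matrix.single p i 1) with hY
  have hfY : ∀ X : Mat N, f X = ∑ p, ∑ i, Y p i * X p i := by
    intro X
    conv_lhs => rw [Matrix.matrix_eq_sum_single X]
    simp only [map_sum, hY]
    refine Finset.sum_congr rfl fun p _ => Finset.sum_congr rfl fun i _ => ?_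
    rw [← mul_one (X p i), ← smul_eq_mul, ← Matrix.smul_single, map_smul]
    simp [mul_comm]
  have q0 : QQ Y Φ = 0 := by
    rw [QQ_kraus Y Φ K h]
    simp only [← hfY]
    rw [Finset.sum_eq_zero]
    · simp
    · intro x _
      rw [hf _ (Submodule.subset_span ⟨x, rfl⟩)]
      simp
  have q1 : QQ Y Φ = t * QQ Y Ψ₁ + ((1 - t : ℝ) : ℂ) * QQ Y Ψ₂ := by
    rw [he]
    simp only [QQ, Finset.mul_sum, ← Finset.sum_add_distrib, LinearMap.add_apply,
      LinearMap.smul_apply, Matrix.add_apply, Matrix.smul_apply, smul_eq_mul]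
    refine Finset.sum_congr rfl fun p _ => Finset.sum_congr rfl fun i _ =>
      Finset.sum_congr rfl fun q _ => Finset.sum_congr rfl fun j _ => ?_
    ring
  rw [q0, QQ_kraus Y Ψ₁ K₁ h₁, QQ_kraus Y Ψ₂ K₂ h₂] at q1
  simp only [← hfY] at q1
  norm_cast at q1
  have p1 : 0 ≤ ∑ m, ‖f (K₁ m)‖ ^ 2 := Finset.sum_nonneg fun _ _ => by positivity
  have p2 : 0 ≤ ∑ m, ‖f (K₂ m)‖ ^ 2 := Finset.sum_nonneg fun _ _ => by positivity
  have p3 : ∑ m, ‖f (K₁ m)‖ ^ 2 = 0 := by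
    have : 0 ≤ (1 - t) * ∑ m, ‖f (K₂ m)‖ ^ 2 := mul_nonneg (by linarith) p2
    have h5 : t * ∑ m, ‖f (K₁ m)‖ ^ 2 ≤ 0 := by linarith
    nlinarith
  rw [Finset.sum_eq_zero_iff_of_nonneg (fun _ _ => by positivity)] at p3
  simpa using p3 m (Finset.mem_univ _)

lemma mpow_one' (σ : Mat N) (hσ : σ.PosDef) : mpow σ hσ 1 = σ := by
  have h := hσ.1.spectral_theorem
  rw [Unitary.conjStarAlgAut_apply] at h
  conv_rhs => rw [h]
  simp only [mpow, Real.rpow_one]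
  rfl

lemma uu1 (σ : Mat N) (hσ : σ.PosDef) :
    star (hσ.1.eigenvectorUnitary : Mat N) * (hσ.1.eigenvectorUnitary : Mat N) = 1 :=
  Unitary.coe_star_mul_self _

lemma uu2 (σ : Mat N) (hσ : σ.PosDef) :
    (hσ.1.eigenvectorUnitary : Mat N) * star (hσ.1.eigenvectorUnitary : Mat N) = 1 :=
  Unitary.coe_mul_star_self _

/-- conjugation to the eigenbasis -/
def cj (σ : Mat N) (hσ : σ.PosDef) (W : Mat N) : Mat N :=
  star (hσ.1.eigenvectorUnitary : Mat N) * W * (hσ.1.eigenvectorUnitary : Mat N)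

lemma cj_mul (σ : Mat N) (hσ : σ.PosDef) (A B : Mat N) :
    cj σ hσ (A * B) = cj σ hσ A * cj σ hσ B := by
  have := uu2 σ hσ
  simp only [cj]
  calc _ = star (hσ.1.eigenvectorUnitary : Mat N) * A * 1 * B *
        (hσ.1.eigenvectorUnitary : Mat N) := by simp only [mul_one, mul_assoc]
    _ = _ := by rw [← this]; simp only [mul_assoc]

lemma cj_inj (σ : Mat N) (hσ : σ.PosDef) (A B : Mat N) (h : cj σ hσ A = cj σ hσ B) : A = B := by
  have h2 := uu2 σ hσ
  have : ∀ A, (hσ.1.eigenvectorUnitary : Mat N) * cj σ hσ A *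
      star (hσ.1.eigenvectorUnitary : Mat N) = A := by
    intro A
    calc _ = ((hσ.1.eigenvectorUnitary : Mat N) * star (hσ.1.eigenvectorUnitary : Mat N)) * A *
        ((hσ.1.eigenvectorUnitary : Mat N) * star (hσ.1.eigenvectorUnitary : Mat N)) := by
          simp only [cj, mul_assoc]
      _ = A := by rw [h2]; simp
  rw [← this A, h, this B]

lemma cj_smul (σ : Mat N) (hσ : σ.PosDef) (z : ℂ) (A : Mat N) :
    cj σ hσ (z • A) = z • cj σ hσ A := by
  simp [cj]

lemma cj_mpow (σ : Mat N) (hσ : σ.PosDef) (s : ℝ) :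
    cj σ hσ (mpow σ hσ s) = Matrix.diagonal (fun i => ((hσ.1.eigenvalues i ^ s : ℝ) : ℂ)) := by
  have h1 := uu1 σ hσ
  simp only [cj, mpow]
  calc _ = (star (hσ.1.eigenvectorUnitary : Mat N) * (hσ.1.eigenvectorUnitary : Mat N)) *
        Matrix.diagonal (fun i => ((hσ.1.eigenvalues i ^ s : ℝ) : ℂ)) *
        (star (hσ.1.eigenvectorUnitary : Mat N) * (hσ.1.eigenvectorUnitary : Mat N)) := by
          simp only [mul_assoc]
    _ = _ := by rw [h1]; simp

lemma cj_one (σ : Mat N) (hσ : σ.PosDef) : cj σ hσ 1 = 1 := by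
  simp only [cj, mul_one]
  exact uu1 σ hσ

lemma mpow_mul_neg (σ : Mat N) (hσ : σ.PosDef) (s : ℝ) :
    mpow σ hσ s * mpow σ hσ (-s) = 1 := by
  apply cj_inj σ hσ
  rw [cj_mul, cj_mpow, cj_mpow, cj_one, Matrix.diagonal_mul_diagonal, ← Matrix.diagonal_one]
  congr 1
  ext i
  have := hσ.eigenvalues_pos i
  rw [← Complex.ofReal_mul, ← Real.rpow_add this]
  simp

lemma mpow_neg_mul (σ : Mat N) (hσ : σ.PosDef) (s : ℝ) :
    mpow σ hσ (-s) * mpow σ hσ s = 1 := by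
  simpa using mpow_mul_neg σ hσ (-s)

lemma eig_entry (σ : Mat N) (hσ : σ.PosDef) (W : Mat N) (ν : ℝ)
    (h : σ * W = (ν : ℂ) • (W * σ)) (i j : Fin N) (hij : cj σ hσ W i j ≠ 0) :
    hσ.1.eigenvalues i = ν * hσ.1.eigenvalues j := by
  have h1 := congrArg (fun A => cj σ hσ A i j) h
  simp only [cj_mul, cj_smul] at h1
  have h2 : cj σ hσ σ = Matrix.diagonal (fun i => ((hσ.1.eigenvalues i : ℝ) : ℂ)) := by
    have := cj_mpow σ hσ 1
    rw [mpow_one'] at this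
    simpa using this
  rw [h2, Matrix.smul_apply, Matrix.diagonal_mul, Matrix.mul_diagonal, smul_eq_mul] at h1
  have h3 : (hσ.1.eigenvalues i : ℂ) = (ν : ℂ) * (hσ.1.eigenvalues j : ℂ) := by
    apply mul_right_cancel₀ hij
    rw [h1]; ring
  exact_mod_cast h3

lemma mpow_comm (σ : Mat N) (hσ : σ.PosDef) (W : Mat N) (ν : ℝ) (hν : 0 < ν)
    (h : σ * W = (ν : ℂ) • (W * σ)) (s : ℝ) :
    mpow σ hσ s * W = ((ν ^ s : ℝ) : ℂ) • (W * mpow σ hσ s) := by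
  apply cj_inj σ hσ
  rw [cj_mul, cj_smul, cj_mul, cj_mpow]
  ext i j
  rw [Matrix.smul_apply, Matrix.diagonal_mul, Matrix.mul_diagonal, smul_eq_mul]
  by_cases hij : cj σ hσ W i j = 0
  · simp [hij]
  · rw [eig_entry σ hσ W ν h i j hij, Real.mul_rpow hν.le (hσ.eigenvalues_pos j).le]
    push_cast
    ring

section sa
variable {ι : Type*} [Fintype ι] (σ : Mat N) (hσ : σ.PosDef) (W : ι → Mat N)
  (iv : ι ≃ ι) (ν : ι → ℝ)

lemma TT_conjTranspose (W : ι → Mat N) (c : Matrix ι ι ℂ) (B : Mat N) :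
    (TT W c B)ᴴ = TT W cᴴ Bᴴ := by
  rw [TT_apply, TT_apply, Finset.sum_comm]
  simp [Matrix.conjTranspose_sum, mul_assoc]

/-- twisted coefficients -/
def ctil (iv : ι ≃ ι) (ν : ι → ℝ) (s : ℝ) (c : Matrix ι ι ℂ) : Matrix ι ι ℂ :=
  fun a b => c (iv b) (iv a) * ((ν a ^ (1 - s) * ν b ^ s : ℝ) : ℂ)

lemma ds_left (hiv : ∀ a, iv (iv a) = a) (hWiv : ∀ a, W (iv a) = (W a)ᴴ)
    (hν : ∀ a, 0 < ν a) (hνiv : ∀ a, ν (iv a) = (ν a)⁻¹)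
    (hE : ∀ a, σ * W a = (ν a : ℂ) • (W a * σ)) (s : ℝ) (c : Matrix ι ι ℂ) (A B : Mat N) :
    dsInner σ hσ s B (TT W c A) =
      (TT W (ctil iv ν s c) Bᴴ * (mpow σ hσ s * A * mpow σ hσ (1 - s))).trace := by
  rw [dsInner, TT_apply, TT_apply, Finset.sum_comm (f := fun a b => ctil iv ν s c a b • _)]
  conv_rhs => enter [1, 1]; rw [← iv.sum_comp]
  conv_rhs => enter [1, 1, 2, a]; rw [← iv.sum_comp]
  simp only [Finset.mul_sum, Finset.sum_mul, Matrix.trace_sum]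
  refine Finset.sum_congr rfl fun a _ => Finset.sum_congr rfl fun b _ => ?_
  simp only [ctil, hiv, hWiv, Matrix.conjTranspose_conjTranspose, Matrix.mul_smul, Matrix.smul_mul,
    Matrix.trace_smul, smul_eq_mul, mul_assoc (c a b)]
  congr 1
  have h1 := mpow_comm σ hσ (W (iv a)) (ν (iv a)) (hν _) (hE _) s
  rw [hWiv] at h1
  have h2 := mpow_comm σ hσ (W b) (ν b) (hν _) (hE _) (1 - s)
  have h3 : W b * mpow σ hσ (1 - s) =
      ((ν (iv b) ^ (1 - s) : ℝ) : ℂ) • (mpow σ hσ (1 - s) * W b) := by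
    rw [h2, smul_smul, ← Complex.ofReal_mul, hνiv, ← Real.mul_rpow (inv_nonneg.mpr (hν b).le)
      (hν b).le, inv_mul_cancel₀ (hν b).ne']
    simp
  calc (Bᴴ * mpow σ hσ s * ((W a)ᴴ * A * W b) * mpow σ hσ (1 - s)).trace
      = (Bᴴ * (mpow σ hσ s * (W a)ᴴ) * A * (W b * mpow σ hσ (1 - s))).trace := by
        simp only [mul_assoc]
    _ = ((ν (iv b) ^ (1 - s) * ν (iv a) ^ s : ℝ) : ℂ) *
        ((Bᴴ * ((W a)ᴴ * mpow σ hσ s) * A * mpow σ hσ (1 - s)) * W b).trace := by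
        rw [h1, h3]
        simp only [Matrix.mul_smul, Matrix.smul_mul, Matrix.trace_smul, smul_eq_mul, mul_assoc]
        push_cast
        ring
    _ = _ := by
        rw [Matrix.trace_mul_comm]
        simp only [mul_assoc]

lemma ds_right (s : ℝ) (c : Matrix ι ι ℂ) (A B : Mat N) :
    dsInner σ hσ s (TT W c B) A =
      (TT W cᴴ Bᴴ * (mpow σ hσ s * A * mpow σ hσ (1 - s))).trace := by
  rw [dsInner, TT_conjTranspose]
  simp only [mul_assoc]

lemma sa_iff (hW : LinearIndependent ℂ W) (hiv : ∀ a, iv (iv a) = a)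
    (hWiv : ∀ a, W (iv a) = (W a)ᴴ)
    (hν : ∀ a, 0 < ν a) (hνiv : ∀ a, ν (iv a) = (ν a)⁻¹)
    (hE : ∀ a, σ * W a = (ν a : ℂ) • (W a * σ)) (s : ℝ) (c : Matrix ι ι ℂ) :
    IsDsSelfAdjoint σ hσ s (TT W c) ↔ ctil iv ν s c = cᴴ := by
  constructor
  · intro h
    apply TT_inj W hW
    ext1 B
    rw [Matrix.ext_iff_trace_mul_right]
    intro X
    have := h (mpow σ hσ (-s) * X * mpow σ hσ (-(1 - s))) Bᴴ
    rw [ds_left σ hσ W iv ν hiv hWiv hν hνiv hE, ds_right] at this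
    have e : mpow σ hσ s * (mpow σ hσ (-s) * X * mpow σ hσ (-(1 - s))) * mpow σ hσ (1 - s)
        = X := by
      calc _ = (mpow σ hσ s * mpow σ hσ (-s)) * X * (mpow σ hσ (-(1 - s)) * mpow σ hσ (1 - s)) := by
            simp only [mul_assoc]
        _ = X := by rw [mpow_mul_neg, mpow_neg_mul]; simp
    rw [e, Matrix.conjTranspose_conjTranspose] at this
    exact this
  · intro h A B
    rw [ds_left σ hσ W iv ν hiv hWiv hν hνiv hE, ds_right, h]

lemma sa_block (hν : ∀ a, 0 < ν a)
    (s : ℝ) (c : Matrix ι ι ℂ) (hc : cᴴ = c)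
    (h : ctil iv ν s c = cᴴ) (a b : ι) (hab : ν a = ν b) :
    c a b = c (iv b) (iv a) * (ν a : ℂ) := by
  rw [hc] at h
  have h1 : c (iv b) (iv a) * ((ν a ^ (1 - s) * ν b ^ s : ℝ) : ℂ) = c a b :=
    congrFun (congrFun h a) b
  rw [← h1, ← hab, ← Real.rpow_add (hν a)]
  simp

/-- Vanishing off the diagonal eigenvalue blocks. -/
lemma sa_support (hiv : ∀ a, iv (iv a) = a)
    (hν : ∀ a, 0 < ν a) (hνiv : ∀ a, ν (iv a) = (ν a)⁻¹)
    (s : ℝ) (hs : s ≠ 1/2) (c : Matrix ι ι ℂ) (hc : cᴴ = c)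
    (h : ctil iv ν s c = cᴴ) (a b : ι) (hab : c a b ≠ 0) :
    ν a = ν b := by
  rw [hc] at h
  have h1 : c (iv b) (iv a) * ((ν a ^ (1 - s) * ν b ^ s : ℝ) : ℂ) = c a b :=
    congrFun (congrFun h a) b
  have h2 : c (iv (iv a)) (iv (iv b)) * ((ν (iv b) ^ (1 - s) * ν (iv a) ^ s : ℝ) : ℂ)
      = c (iv b) (iv a) := congrFun (congrFun h (iv b)) (iv a)
  rw [hiv, hiv, hνiv, hνiv] at h2
  have pa := hν a
  have pb := hν b
  have h3 : ((ν b)⁻¹ ^ (1 - s) * (ν a)⁻¹ ^ s) * (ν a ^ (1 - s) * ν b ^ s) = 1 := by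
    rw [← h2, mul_assoc, ← Complex.ofReal_mul] at h1
    have := mul_left_cancel₀ hab (h1.trans (mul_one _).symm)
    exact_mod_cast this
  have h4 : (ν a) ^ (1 - 2 * s) = (ν b) ^ (1 - 2 * s) := by
    rw [Real.inv_rpow pa.le, Real.inv_rpow pb.le] at h3
    have e1 : (ν a) ^ (1 - 2 * s) = ν a ^ (1 - s) / ν a ^ s := by
      rw [← Real.rpow_sub pa]; congr 1; ring
    have e2 : (ν b) ^ (1 - 2 * s) = ν b ^ (1 - s) / ν b ^ s := by
      rw [← Real.rpow_sub pb]; congr 1; ring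
    have q1 := Real.rpow_pos_of_pos pa s
    have q2 := Real.rpow_pos_of_pos pb s
    have q3 := Real.rpow_pos_of_pos pb (1 - s)
    rw [e1, e2]
    field_simp at h3 ⊢
    linarith
  have h0 : 1 - 2 * s ≠ 0 := fun h => hs (by linarith)
  exact (Real.rpow_left_inj pa.le pb.le h0).mp h4
end sa

section blk
variable {P : Type*} [Fintype P] [DecidableEq P]

/-- the family together with its adjoints -/
def WW (v : P → Mat N) : P ⊕ P → Mat N := Sum.elim v (fun p => (v p)ᴴ)

/-- eigenvalues -/
def nn (m : P → ℝ) : P ⊕ P → ℝ := Sum.elim m (fun p => (m p)⁻¹)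

/-- the coefficient matrix -/
def EE (m : P → ℝ) (g : Matrix P P ℂ) : Matrix (P ⊕ P) (P ⊕ P) ℂ :=
  Matrix.fromBlocks (Matrix.of fun p q => (Real.sqrt (m p) : ℂ) * g p q) 0 0
    (Matrix.of fun p q => ((Real.sqrt (m q))⁻¹ : ℂ) * g q p)

lemma adj_eig (σ : Mat N) (hσ : σ.PosDef) (v : Mat N) (m : ℝ) (hm : 0 < m)
    (h : σ * v = (m : ℂ) • (v * σ)) : σ * vᴴ = ((m⁻¹ : ℝ) : ℂ) • (vᴴ * σ) := by
  have h1 := congrArg Matrix.conjTranspose h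
  have hs : σᴴ = σ := hσ.1
  simp only [Matrix.conjTranspose_mul, Matrix.conjTranspose_smul, hs] at h1
  rw [h1, smul_smul]
  have : (m : ℂ) ≠ 0 := by exact_mod_cast hm.ne'
  simp [this]

lemma WW_li (σ : Mat N) (hσ : σ.PosDef) (v : P → Mat N) (m : P → ℝ) (hm : ∀ p, 1 < m p)
    (hE : ∀ p, σ * v p = (m p : ℂ) • (v p * σ)) (hv : LinearIndependent ℂ v) :
    LinearIndependent ℂ (WW v) := by
  rw [Fintype.linearIndependent_iff] at hv ⊢
  intro g hg
  rw [Fintype.sum_sum_type] at hg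
  simp only [WW, Sum.elim_inl, Sum.elim_inr] at hg
  have cjs : ∀ (f : P → ℂ) (w : P → Mat N),
      cj σ hσ (∑ p, f p • w p) = ∑ p, f p • cj σ hσ (w p) := by
    intro f w
    simp [cj, Finset.mul_sum, Finset.sum_mul]
  have h0 : ∑ p, g (Sum.inl p) • v p = 0 := by
    apply cj_inj σ hσ
    ext i j
    have z : cj σ hσ 0 = 0 := by simp [cj]
    rw [z, Matrix.zero_apply]
    by_cases hij : hσ.1.eigenvalues i ≤ hσ.1.eigenvalues j
    · rw [cjs, Matrix.sum_apply]
      apply Finset.sum_eq_zero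
      intro p _
      rw [Matrix.smul_apply]
      by_contra hne
      have h1 : cj σ hσ (v p) i j ≠ 0 := fun h => hne (by rw [h]; simp)
      have h2 := eig_entry σ hσ _ _ (hE p) i j h1
      nlinarith [hm p, hσ.eigenvalues_pos j]
    · rw [eq_neg_of_add_eq_zero_left hg, ← Finset.sum_neg_distrib]
      simp only [← neg_smul]
      rw [cjs, Matrix.sum_apply]
      apply Finset.sum_eq_zero
      intro p _
      rw [Matrix.smul_apply]
      by_contra hne
      have h1 : cj σ hσ ((v p)ᴴ) i j ≠ 0 := fun h => hne (by rw [h]; simp)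
      have hp : 0 < m p := by linarith [hm p]
      have h2 := eig_entry σ hσ _ _ (adj_eig σ hσ _ _ hp (hE p)) i j h1
      have h3 : (m p)⁻¹ < 1 := inv_lt_one_of_one_lt₀ (hm p)
      nlinarith [hσ.eigenvalues_pos j]
  rw [h0, zero_add] at hg
  have h1 := hv _ h0
  have hg2 := congrArg Matrix.conjTranspose hg
  simp only [Matrix.conjTranspose_sum, Matrix.conjTranspose_smul,
    Matrix.conjTranspose_conjTranspose, Matrix.conjTranspose_zero] at hg2
  have h2 := hv _ hg2
  rintro (p | p)
  · exact h1 p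
  · simpa using h2 p

lemma TT_EE (v : P → Mat N) (m : P → ℝ) (g : Matrix P P ℂ) (A : Mat N) :
    TT (WW v) (EE m g) A = ∑ p, ∑ q, g p q • ((Real.sqrt (m p) : ℂ) • ((v p)ᴴ * A * v q) +
      ((Real.sqrt (m p))⁻¹ : ℂ) • (v q * A * (v p)ᴴ)) := by
  rw [TT_apply]
  simp only [Fintype.sum_sum_type, EE, WW, Matrix.fromBlocks_apply₁₁, Matrix.fromBlocks_apply₁₂,
    Matrix.fromBlocks_apply₂₁, Matrix.fromBlocks_apply₂₂, Sum.elim_inl, Sum.elim_inr,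
    Matrix.zero_apply, zero_smul, Finset.sum_const_zero, add_zero, zero_add, Matrix.of_apply,
    Matrix.conjTranspose_conjTranspose, smul_add, Finset.sum_add_distrib, smul_smul]
  congr 1
  · simp only [mul_comm]
  · rw [Finset.sum_comm]
    simp only [mul_comm]

lemma EE_add (m : P → ℝ) (g h : Matrix P P ℂ) : EE m (g + h) = EE m g + EE m h := by
  ext (p | p) (q | q) <;> simp [EE, mul_add]

lemma EE_smul (m : P → ℝ) (z : ℂ) (g : Matrix P P ℂ) : EE m (z • g) = z • EE m g := by
  ext (p | p) (q | q) <;> simp [EE] <;> ring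

lemma EE_herm (m : P → ℝ) (g : Matrix P P ℂ) (hg : gᴴ = g)
    (hb : ∀ p q, m p ≠ m q → g p q = 0) : (EE m g)ᴴ = EE m g := by
  have hs : ∀ p q, star (g p q) = g q p := fun p q => congrFun (congrFun hg q) p
  have hsw : ∀ p q, m p = m q ∨ g p q = 0 ∧ g q p = 0 := by
    intro p q
    by_cases h : m p = m q
    · exact Or.inl h
    · exact Or.inr ⟨hb _ _ h, hb _ _ (Ne.symm h)⟩
  ext (p | p) (q | q)
  · simp only [EE, Matrix.conjTranspose_apply, Matrix.fromBlocks_apply₁₁, Matrix.of_apply,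
      star_mul', hs]
    rcases hsw p q with h | ⟨h, -⟩
    · simp [h]
    · simp [h]
  · simp [EE]
  · simp [EE]
  · simp only [EE, Matrix.conjTranspose_apply, Matrix.fromBlocks_apply₂₂, Matrix.of_apply,
      star_mul', hs]
    rcases hsw p q with h | ⟨-, h⟩
    · simp [h]
    · simp [h]

lemma EE_ctil (m : P → ℝ) (hm : ∀ p, 1 < m p) (s : ℝ) (g : Matrix P P ℂ)
    (hb : ∀ p q, m p ≠ m q → g p q = 0) :
    ctil (Equiv.sumComm P P) (nn m) s (EE m g) = EE m g := by
  have hsq : ∀ p, (Real.sqrt (m p) : ℂ)⁻¹ * (m p : ℂ) = Real.sqrt (m p) := by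
    intro p
    have h1 : Real.sqrt (m p) * Real.sqrt (m p) = m p :=
      Real.mul_self_sqrt (by linarith [hm p])
    have h2 : (Real.sqrt (m p) : ℂ) ≠ 0 := by
      have : 0 < Real.sqrt (m p) := Real.sqrt_pos.mpr (by linarith [hm p])
      exact_mod_cast this.ne'
    have h3 : (m p : ℂ) = Real.sqrt (m p) * Real.sqrt (m p) := by exact_mod_cast h1.symm
    rw [h3, inv_mul_cancel_left₀ h2]
  have hsq2 : ∀ p, (Real.sqrt (m p) : ℂ) * (m p : ℂ)⁻¹ = (Real.sqrt (m p) : ℂ)⁻¹ := by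
    intro p
    have := congrArg (fun z => z⁻¹) (hsq p)
    simp only [mul_inv, inv_inv] at this
    exact this
  ext (p | p) (q | q)
  · simp only [ctil, EE, nn, Equiv.sumComm_apply, Sum.swap_inl, Matrix.fromBlocks_apply₁₁,
      Matrix.fromBlocks_apply₂₂, Matrix.of_apply, Sum.elim_inl]
    by_cases h : m p = m q
    · rw [← h, ← Real.rpow_add (by linarith [hm p])]
      rw [sub_add_cancel, Real.rpow_one, mul_right_comm, hsq]
    · simp [hb _ _ h]
  · simp [ctil, EE]
  · simp [ctil, EE]
  · simp only [ctil, EE, nn, Equiv.sumComm_apply, Sum.swap_inr, Matrix.fromBlocks_apply₁₁,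
      Matrix.fromBlocks_apply₂₂, Matrix.of_apply, Sum.elim_inr]
    by_cases h : m p = m q
    · rw [h, ← Real.rpow_add (inv_pos.mpr (by linarith [hm q]))]
      rw [sub_add_cancel, Real.rpow_one, mul_right_comm, Complex.ofReal_inv, hsq2]
    · simp [hb _ _ (Ne.symm h)]

lemma EE_one (m : P → ℝ) : EE m 1 = Matrix.diagonal
    (fun a => ((Sum.elim (fun p => Real.sqrt (m p)) (fun p => (Real.sqrt (m p))⁻¹) a : ℝ) : ℂ)) := by
  ext (p | p) (q | q)
  · by_cases h : p = q
    · subst h; simp [EE]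
    · simp [EE, Matrix.one_apply, Matrix.diagonal_apply, h]
  · simp [EE]
  · simp [EE]
  · by_cases h : p = q
    · subst h; simp [EE]
    · simp [EE, Matrix.one_apply, Matrix.diagonal_apply, h, Ne.symm h]

open scoped MatrixOrder Matrix.Norms.L2Operator in
lemma perturb {ι : Type*} [Fintype ι] [DecidableEq ι] (d : ι → ℝ) (hd : ∀ a, 0 < d a)
    (H : Matrix ι ι ℂ) (hH : Hᴴ = H) :
    ∃ ε : ℝ, 0 < ε ∧ (Matrix.diagonal (fun a => (d a : ℂ)) + (ε : ℂ) • H).PosSemidef ∧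
      (Matrix.diagonal (fun a => (d a : ℂ)) + (-ε : ℂ) • H).PosSemidef := by
  obtain ⟨δ, hδ, hδd⟩ : ∃ δ : ℝ, 0 < δ ∧ ∀ a, δ ≤ d a := by
    rcases isEmpty_or_nonempty ι with h | h
    · exact ⟨1, one_pos, fun a => (h.false a).elim⟩
    · obtain ⟨a, ha⟩ := Finite.exists_min d
      exact ⟨d a, hd a, ha⟩
  have key : ∀ K : Matrix ι ι ℂ, Kᴴ = K → ∀ r : ℝ, ‖K‖ ≤ r → 0 < r →
      (Matrix.diagonal (fun a => (d a : ℂ)) + ((δ / r : ℝ) : ℂ) • K).PosSemidef := by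
    intro K hK r hr hr0
    have h1 : -(algebraMap ℝ (Matrix ι ι ℂ)) ‖K‖ ≤ K :=
      IsSelfAdjoint.neg_algebraMap_norm_le_self (show IsSelfAdjoint K from hK)
    rw [Matrix.le_iff] at h1
    have e : Matrix.diagonal (fun a => (d a : ℂ)) + ((δ / r : ℝ) : ℂ) • K =
        Matrix.diagonal (fun a => ((d a - δ / r * ‖K‖ : ℝ) : ℂ)) +
          ((δ / r : ℝ) : ℂ) • (K - -(algebraMap ℝ (Matrix ι ι ℂ)) ‖K‖) := by
      ext a b
      by_cases h : a = b
      · subst h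
        simp [Matrix.algebraMap_matrix_apply]
      · simp [Matrix.algebraMap_matrix_apply, h]
    rw [e]
    refine Matrix.PosSemidef.add ?_ (h1.smul ?_)
    · rw [Matrix.posSemidef_diagonal_iff]
      intro a
      have : δ / r * ‖K‖ ≤ δ := by
        rw [div_mul_eq_mul_div, div_le_iff₀ hr0]
        exact mul_le_mul_of_nonneg_left hr hδ.le
      exact_mod_cast sub_nonneg.mpr (this.trans (hδd a))
    · have : 0 ≤ δ / r := by positivity
      exact_mod_cast this
  have hr0 : 0 < ‖H‖ + 1 := by positivity
  refine ⟨δ / (‖H‖ + 1), by positivity, key H hH _ (by linarith) hr0, ?_⟩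
  have := key (-H) (by rw [Matrix.conjTranspose_neg, hH]) (‖H‖ + 1) (by rw [norm_neg]; linarith) hr0
  rwa [smul_neg, ← neg_smul] at this

lemma exists_coeff {ι : Type*} [Fintype ι] [DecidableEq ι] (W : ι → Mat N) (d : ι → ℝ)
    (hd : ∀ a, 0 < d a)
    (Φ Ψ₁ Ψ₂ : Mat N →ₗ[ℂ] Mat N) (hΦ : Φ = TT W (Matrix.diagonal (fun a => (d a : ℂ))))
    (h₁ : IsCP Ψ₁) (h₂ : IsCP Ψ₂) (t : ℝ) (ht : 0 < t) (ht1 : t < 1)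
    (he : Φ = (t : ℂ) • Ψ₁ + ((1 - t : ℝ) : ℂ) • Ψ₂) :
    ∃ c : Matrix ι ι ℂ, cᴴ = c ∧ Ψ₁ = TT W c := by
  obtain ⟨M₁, K₁, hK₁⟩ := h₁
  obtain ⟨M₂, K₂, hK₂⟩ := h₂
  have hB : Matrix.diagonal (fun a => (d a : ℂ)) =
      (Matrix.diagonal (fun a => (Real.sqrt (d a) : ℂ)))ᴴ *
        Matrix.diagonal (fun a => (Real.sqrt (d a) : ℂ)) := by
    rw [Matrix.diagonal_conjTranspose, Matrix.diagonal_mul_diagonal]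
    congr 1
    ext a
    have := Real.mul_self_sqrt (hd a).le
    simp only [Pi.star_apply, RCLike.star_def, Complex.conj_ofReal]
    exact_mod_cast this.symm
  rw [hB] at hΦ
  have hs := kraus_span Φ Ψ₁ Ψ₂ _ K₁ K₂ (fun A => by rw [hΦ]; exact TT_gram W _ A) hK₁ hK₂ t ht ht1 he
  have hs2 : ∀ m, ∃ f : ι → ℂ, ∑ a, f a • W a = K₁ m := by
    intro m
    rw [← Submodule.mem_span_range_iff_exists_fun]
    refine Submodule.span_le.mpr ?_ (hs m)
    rintro _ ⟨x, rfl⟩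
    exact Submodule.sum_mem _ fun a _ => Submodule.smul_mem _ _ (Submodule.subset_span ⟨a, rfl⟩)
  choose f hf using hs2
  refine ⟨(Matrix.of f)ᴴ * Matrix.of f, by simp, ?_⟩
  ext1 A
  rw [TT_gram, hK₁]
  simp [hf]

end blk

section fin
variable {P : Type*} [Fintype P] [DecidableEq P]

lemma WW_iv (v : P → Mat N) (a : P ⊕ P) : WW v (Equiv.sumComm P P a) = (WW v a)ᴴ := by
  rcases a with a | a <;> simp [WW]

lemma nn_iv (m : P → ℝ) (a : P ⊕ P) : nn m (Equiv.sumComm P P a) = (nn m a)⁻¹ := by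
  rcases a with a | a <;> simp [nn]

lemma nn_pos (m : P → ℝ) (hm : ∀ p, 1 < m p) (a : P ⊕ P) : 0 < nn m a := by
  rcases a with a | a
  · simpa [nn] using zero_lt_one.trans (hm a)
  · simpa [nn] using zero_lt_one.trans (hm a)

lemma WW_eig (σ : Mat N) (hσ : σ.PosDef) (v : P → Mat N) (m : P → ℝ) (hm : ∀ p, 1 < m p)
    (hE : ∀ p, σ * v p = (m p : ℂ) • (v p * σ)) (a : P ⊕ P) :
    σ * WW v a = (nn m a : ℂ) • (WW v a * σ) := by
  rcases a with a | a
  · exact hE a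
  · exact adj_eig σ hσ _ _ (zero_lt_one.trans (hm a)) (hE a)

lemma EE_sa (σ : Mat N) (hσ : σ.PosDef) (v : P → Mat N) (m : P → ℝ) (hm : ∀ p, 1 < m p)
    (hE : ∀ p, σ * v p = (m p : ℂ) • (v p * σ)) (hv : LinearIndependent ℂ v) (s : ℝ)
    (g : Matrix P P ℂ) (hg : gᴴ = g) (hb : ∀ p q, m p ≠ m q → g p q = 0) :
    IsDsSelfAdjoint σ hσ s (TT (WW v) (EE m g)) := by
  rw [sa_iff σ hσ (WW v) (Equiv.sumComm P P) (nn m) (WW_li σ hσ v m hm hE hv)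
    (fun a => by simp) (WW_iv v) (nn_pos m hm) (nn_iv m) (WW_eig σ hσ v m hm hE)]
  rw [EE_ctil m hm s g hb, EE_herm m g hg hb]

lemma d_pos (m : P → ℝ) (hm : ∀ p, 1 < m p) (a : P ⊕ P) :
    0 < Sum.elim (fun p => Real.sqrt (m p)) (fun p => (Real.sqrt (m p))⁻¹) a := by
  rcases a with a | a
  · exact Real.sqrt_pos.mpr (zero_lt_one.trans (hm a))
  · exact inv_pos.mpr (Real.sqrt_pos.mpr (zero_lt_one.trans (hm a)))

lemma form_of_dominated (σ : Mat N) (hσ : σ.PosDef) (v : P → Mat N) (m : P → ℝ)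
    (hm : ∀ p, 1 < m p)
    (hE : ∀ p, σ * v p = (m p : ℂ) • (v p * σ)) (hv : LinearIndependent ℂ v)
    (s : ℝ) (hs : s ≠ 1/2) (Φ Ψ₁ Ψ₂ : Mat N →ₗ[ℂ] Mat N) (hΦ : Φ = TT (WW v) (EE m 1))
    (h₁ : IsCP Ψ₁) (hsa : IsDsSelfAdjoint σ hσ s Ψ₁) (h₂ : IsCP Ψ₂)
    (t : ℝ) (ht : 0 < t) (ht1 : t < 1)
    (he : Φ = (t : ℂ) • Ψ₁ + ((1 - t : ℝ) : ℂ) • Ψ₂) :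
    ∃ g : Matrix P P ℂ, (∀ p q, m p ≠ m q → g p q = 0) ∧ Ψ₁ = TT (WW v) (EE m g) := by
  rw [EE_one] at hΦ
  obtain ⟨c, hc, rfl⟩ := exists_coeff (WW v) _ (d_pos m hm) Φ Ψ₁ Ψ₂ hΦ h₁ h₂ t ht ht1 he
  rw [sa_iff σ hσ (WW v) (Equiv.sumComm P P) (nn m) (WW_li σ hσ v m hm hE hv)
    (fun a => by simp) (WW_iv v) (nn_pos m hm) (nn_iv m) (WW_eig σ hσ v m hm hE)] at hsa
  have hsupp : ∀ a b, nn m a ≠ nn m b → c a b = 0 := by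
    intro a b hab
    by_contra h
    exact hab (sa_support (Equiv.sumComm P P) (nn m) (fun a => by simp) (nn_pos m hm) (nn_iv m)
      s hs c hc hsa a b h)
  have hblk := sa_block (Equiv.sumComm P P) (nn m) (nn_pos m hm) s c hc hsa
  have hlt : ∀ p, (m p)⁻¹ < 1 := fun p => inv_lt_one_of_one_lt₀ (hm p)
  have hsq0 : ∀ p, (Real.sqrt (m p) : ℂ) ≠ 0 := by
    intro p
    have : 0 < Real.sqrt (m p) := Real.sqrt_pos.mpr (by linarith [hm p])
    exact_mod_cast this.ne'
  have hsq : ∀ p, (m p : ℂ) = Real.sqrt (m p) * Real.sqrt (m p) := by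
    intro p
    have h1 : Real.sqrt (m p) * Real.sqrt (m p) = m p :=
      Real.mul_self_sqrt (by linarith [hm p])
    exact_mod_cast h1.symm
  have hll : ∀ p q, m p ≠ m q → c (Sum.inl p) (Sum.inl q) = 0 := fun p q h => hsupp _ _ h
  refine ⟨Matrix.of fun p q => (Real.sqrt (m p) : ℂ)⁻¹ * c (Sum.inl p) (Sum.inl q), ?_, ?_⟩
  · intro p q h
    simp [hll p q h]
  · congr 1
    ext (p | p) (q | q)
    · simp [EE, mul_inv_cancel_left₀ (hsq0 p)]
    · rw [hsupp (Sum.inl p) (Sum.inr q) (show m p ≠ (m q)⁻¹ from ((hlt q).trans (hm p)).ne')]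
      simp [EE]
    · rw [hsupp (Sum.inr p) (Sum.inl q) (show (m p)⁻¹ ≠ m q from ((hlt p).trans (hm q)).ne)]
      simp [EE]
    · simp only [EE, Matrix.fromBlocks_apply₂₂, Matrix.of_apply]
      by_cases h : m p = m q
      · have := hblk (Sum.inr p) (Sum.inr q) (by simp [nn, h])
        rw [this]
        simp only [nn, Sum.elim_inr, Equiv.sumComm_apply, Sum.swap_inr, h]
        rw [Complex.ofReal_inv, hsq q, mul_inv]
        ring
      · rw [hll _ _ (Ne.symm h), 
          hsupp (Sum.inr p) (Sum.inr q) (show (m p)⁻¹ ≠ (m q)⁻¹ from fun h' => h (inv_injective h'))]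
        simp

lemma EE_inj (m : P → ℝ) (hm : ∀ p, 1 < m p) (g : Matrix P P ℂ) (h : EE m g = 0) : g = 0 := by
  ext p q
  have h1 := congrFun (congrFun h (Sum.inl p)) (Sum.inl q)
  have hsq0 : (Real.sqrt (m p) : ℂ) ≠ 0 := by
    have : 0 < Real.sqrt (m p) := Real.sqrt_pos.mpr (by linarith [hm p])
    exact_mod_cast this.ne'
  simpa [EE, hsq0, (zero_lt_one.trans (hm p)).not_ge, (zero_lt_one.trans (hm p)).ne'] using h1

lemma herm_zero_of_extreme (σ : Mat N) (hσ : σ.PosDef) (v : P → Mat N) (m : P → ℝ)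
    (hm : ∀ p, 1 < m p)
    (hE : ∀ p, σ * v p = (m p : ℂ) • (v p * σ)) (hv : LinearIndependent ℂ v)
    (s : ℝ) (Φ : Mat N →ₗ[ℂ] Mat N) (hΦ : Φ = TT (WW v) (EE m 1)) (hΦu : Φ 1 = 1)
    (hext : ∀ Ψ₁ Ψ₂ : Mat N →ₗ[ℂ] Mat N,
        IsCP Ψ₁ → IsDsSelfAdjoint σ hσ s Ψ₁ → Ψ₁ 1 = 1 →
        IsCP Ψ₂ → IsDsSelfAdjoint σ hσ s Ψ₂ → Ψ₂ 1 = 1 →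
        ∀ t : ℝ, 0 < t → t < 1 →
          Φ = (t : ℂ) • Ψ₁ + ((1 - t : ℝ) : ℂ) • Ψ₂ → Ψ₁ = Φ ∧ Ψ₂ = Φ)
    (g : Matrix P P ℂ) (hg : gᴴ = g) (hb : ∀ p q, m p ≠ m q → g p q = 0)
    (h0 : TT (WW v) (EE m g) 1 = 0) : g = 0 := by
  obtain ⟨ε, hε, hp, hn⟩ := perturb _ (d_pos m hm) (EE m g) (EE_herm m g hg hb)
  rw [← EE_one, ← EE_smul, ← EE_add] at hp hn
  have hsa : ∀ r : ℝ, IsDsSelfAdjoint σ hσ s (TT (WW v) (EE m (1 + (r : ℂ) • g))) := by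
    intro r
    apply EE_sa σ hσ v m hm hE hv
    · simp [hg]
    · intro p q h
      have : p ≠ q := fun h' => h (by rw [h'])
      simp [hb p q h, this]
  have hu : ∀ r : ℂ, TT (WW v) (EE m (1 + r • g)) 1 = 1 := by
    intro r
    rw [EE_add, EE_smul, TT_add, TT_smul, LinearMap.add_apply, LinearMap.smul_apply, h0, ← hΦ, hΦu]
    simp
  have := hext (TT (WW v) (EE m (1 + (ε : ℂ) • g))) (TT (WW v) (EE m (1 + (-ε : ℂ) • g)))
    (TT_cp _ _ hp) (hsa ε) (hu _) (TT_cp _ _ hn) (by simpa using hsa (-ε)) (hu _) (1/2)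
    (by norm_num) (by norm_num) (by
      rw [hΦ]
      simp only [EE_add, EE_smul, TT_add, TT_smul]
      push_cast
      module)
  have h1 := this.1
  rw [hΦ] at h1
  have h2 := TT_inj _ (WW_li σ hσ v m hm hE hv) _ _ h1
  rw [EE_add] at h2
  have h3 : EE m ((ε : ℂ) • g) = 0 := by simpa using h2
  have h4 := EE_inj m hm _ h3
  rcases smul_eq_zero.mp h4 with h | h
  · exact absurd (by exact_mod_cast h) hε.ne'
  · exact h

end fin

lemma bd_sum {d : ℕ} {Mj : Fin d → ℕ} (e : (Σ j : Fin d, Fin (Mj j) × Fin (Mj j)) → ℂ)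
    (F : (Σ j : Fin d, Fin (Mj j)) → (Σ j : Fin d, Fin (Mj j)) → Mat N) :
    ∑ p, ∑ q, (Matrix.blockDiagonal' (fun j => Matrix.of fun k l => e ⟨j, k, l⟩)) p q • F p q =
      ∑ x, e x • F ⟨x.1, x.2.1⟩ ⟨x.1, x.2.2⟩ := by
  rw [Fintype.sum_sigma, Fintype.sum_sigma]
  refine Finset.sum_congr rfl fun j _ => ?_
  rw [Fintype.sum_prod_type]
  refine Finset.sum_congr rfl fun k _ => ?_
  rw [Fintype.sum_sigma, Finset.sum_eq_single j]
  · refine Finset.sum_congr rfl fun l _ => ?_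
    rw [Matrix.blockDiagonal'_apply_eq]
    rfl
  · intro j' _ hj
    refine Finset.sum_eq_zero fun l _ => ?_
    rw [Matrix.blockDiagonal'_apply_ne _ _ _ hj.symm, zero_smul]
  · simp

/-- extreme-point criterion for a unital CP map, self-adjoint with respect to
`⟨·,·⟩_{δ_s}` (`s ≠ 1/2`), presented in a canonical minimal Kraus representation: `Φ` is an
extreme point of the convex set of unital CP `δ_s`-self-adjoint maps iff the family
`X^{(j)}_{k,ℓ} = μ_j^{1/2} V_k^{(j)ᴴ} V_ℓ^{(j)} + μ_j^{-1/2} V_ℓ^{(j)} V_k^{(j)ᴴ}` is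
linearly independent. -/
theorem ds_unital_extreme_iff (N : ℕ) (hN : 2 ≤ N) (σ : Mat N) (hσ : σ.PosDef)
    (htr : σ.trace = 1) (s : ℝ) (hs : s ∈ Set.Icc (0:ℝ) 1) (hs' : s ≠ 1/2)
    (d : ℕ) (Mj : Fin d → ℕ) (μ : Fin d → ℝ)
    (hmono : StrictMono μ) (hμ : ∀ j, 1 < μ j)
    (V : (j : Fin d) → Fin (Mj j) → Mat N)
    (hlin : LinearIndependent ℂ (fun p : Σ j : Fin d, Fin (Mj j) => V p.1 p.2))
    (heig : ∀ j k, σ * V j k * σ⁻¹ = (μ j : ℂ) • V j k)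
    (Φ : Mat N →ₗ[ℂ] Mat N) (hΦcp : IsCP Φ) (hΦu : Φ 1 = 1)
    (hΦsa : IsDsSelfAdjoint σ hσ s Φ)
    (hΦ : ∀ A, Φ A = ∑ j, ∑ k, ((Real.sqrt (μ j) : ℂ) • ((V j k)ᴴ * A * V j k) +
        ((Real.sqrt (μ j))⁻¹ : ℂ) • (V j k * A * (V j k)ᴴ))) :
    (∀ Ψ₁ Ψ₂ : Mat N →ₗ[ℂ] Mat N,
        IsCP Ψ₁ → IsDsSelfAdjoint σ hσ s Ψ₁ → Ψ₁ 1 = 1 →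
        IsCP Ψ₂ → IsDsSelfAdjoint σ hσ s Ψ₂ → Ψ₂ 1 = 1 →
        ∀ t : ℝ, 0 < t → t < 1 →
          Φ = (t : ℂ) • Ψ₁ + ((1 - t : ℝ) : ℂ) • Ψ₂ → Ψ₁ = Φ ∧ Ψ₂ = Φ) ↔
      LinearIndependent ℂ
        (fun p : Σ j : Fin d, Fin (Mj j) × Fin (Mj j) =>
          (Real.sqrt (μ p.1) : ℂ) • ((V p.1 p.2.1)ᴴ * V p.1 p.2.2) +
            ((Real.sqrt (μ p.1))⁻¹ : ℂ) • (V p.1 p.2.2 * (V p.1 p.2.1)ᴴ)) := by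
    classical
  set v : (Σ j : Fin d, Fin (Mj j)) → Mat N := fun p => V p.1 p.2 with hv
  set m : (Σ j : Fin d, Fin (Mj j)) → ℝ := fun p => μ p.1 with hmdef
  have hm : ∀ p, 1 < m p := fun p => hμ p.1
  have hdet : IsUnit σ.det := (Matrix.isUnit_iff_isUnit_det σ).mp hσ.isUnit
  have hE : ∀ p, σ * v p = (m p : ℂ) • (v p * σ) := by
    intro p
    have := congrArg (fun A => A * σ) (heig p.1 p.2)
    simp only [Matrix.smul_mul] at this
    rw [mul_assoc, Matrix.nonsing_inv_mul _ hdet, mul_one] at this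
    exact this
  set X : (Σ j : Fin d, Fin (Mj j) × Fin (Mj j)) → Mat N := fun p =>
          (Real.sqrt (μ p.1) : ℂ) • ((V p.1 p.2.1)ᴴ * V p.1 p.2.2) +
            ((Real.sqrt (μ p.1))⁻¹ : ℂ) • (V p.1 p.2.2 * (V p.1 p.2.1)ᴴ) with hX
  have hΦT : Φ = TT (WW v) (EE m 1) := by
    ext1 A
    rw [hΦ, TT_EE, Fintype.sum_sigma]
    refine Finset.sum_congr rfl fun j _ => Finset.sum_congr rfl fun k _ => ?_
    rw [Finset.sum_eq_single (⟨j, k⟩ : Σ j : Fin d, Fin (Mj j))]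
    · simp [hv, hmdef]
    · intro b _ hb
      rw [Matrix.one_apply_ne hb.symm, zero_smul]
    · simp
  have hT1 : ∀ e : (Σ j : Fin d, Fin (Mj j) × Fin (Mj j)) → ℂ,
      TT (WW v) (EE m (Matrix.blockDiagonal' (fun j => Matrix.of fun k l => e ⟨j, k, l⟩))) 1 =
        ∑ x, e x • X x := by
    intro e
    rw [TT_EE, bd_sum e (fun p q => (Real.sqrt (m p) : ℂ) • ((v p)ᴴ * 1 * v q) +
      ((Real.sqrt (m p))⁻¹ : ℂ) • (v q * 1 * (v p)ᴴ))]
    simp [hX, hv, hmdef]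
  have hbd : ∀ g : Matrix (Σ j : Fin d, Fin (Mj j)) (Σ j : Fin d, Fin (Mj j)) ℂ,
      (∀ p q, m p ≠ m q → g p q = 0) →
      g = Matrix.blockDiagonal' (fun j => Matrix.of fun k l =>
        (fun x : (Σ j : Fin d, Fin (Mj j) × Fin (Mj j)) => g ⟨x.1, x.2.1⟩ ⟨x.1, x.2.2⟩)
          ⟨j, k, l⟩) := by
    intro g hg
    ext ⟨j, k⟩ ⟨j', l⟩
    by_cases h : j = j'
    · subst h
      rw [Matrix.blockDiagonal'_apply_eq]
      rfl
    · rw [Matrix.blockDiagonal'_apply_ne _ _ _ h]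
      exact hg _ _ (fun h' => h (hmono.injective h'))
  constructor
  · intro hext
    have hherm : ∀ e : (Σ j : Fin d, Fin (Mj j) × Fin (Mj j)) → ℂ,
        (∀ j k l, star (e ⟨j, k, l⟩) = e ⟨j, l, k⟩) → ∑ x, e x • X x = 0 → ∀ x, e x = 0 := by
      intro e he h0 x
      have := herm_zero_of_extreme σ hσ v m hm hE hlin s Φ hΦT hΦu hext
        (Matrix.blockDiagonal' (fun j => Matrix.of fun k l => e ⟨j, k, l⟩))
        (by
          rw [Matrix.blockDiagonal'_conjTranspose]
          congr 1
          ext j k l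
          simpa using he j l k)
        (by
          rintro ⟨j, k⟩ ⟨j', l⟩ h
          exact Matrix.blockDiagonal'_apply_ne _ _ _ (fun h' => h (by simp [hmdef, h'])))
        (by rw [hT1, h0])
      have h2 := congrFun (congrFun this ⟨x.1, x.2.1⟩) ⟨x.1, x.2.2⟩
      rw [Matrix.blockDiagonal'_apply_eq] at h2
      exact h2
    rw [Fintype.linearIndependent_iff]
    intro e h0
    have sw : ∀ f : (Σ j : Fin d, Fin (Mj j) × Fin (Mj j)) → Mat N,
        ∑ x, f x = ∑ x : (Σ j : Fin d, Fin (Mj j) × Fin (Mj j)), f ⟨x.1, x.2.2, x.2.1⟩ := by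
      intro f
      rw [Fintype.sum_sigma, Fintype.sum_sigma]
      refine Finset.sum_congr rfl fun j _ => ?_
      rw [Fintype.sum_prod_type, Fintype.sum_prod_type, Finset.sum_comm]
    have h0' : ∑ x : (Σ j : Fin d, Fin (Mj j) × Fin (Mj j)),
        star (e ⟨x.1, x.2.2, x.2.1⟩) • X x = 0 := by
      have h1 := congrArg Matrix.conjTranspose h0
      rw [Matrix.conjTranspose_sum, sw] at h1
      rw [← Matrix.conjTranspose_zero, ← h1]
      refine Finset.sum_congr rfl fun x _ => ?_
      rw [Matrix.conjTranspose_smul]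
      congr 1
      simp [hX]
    have r1 := hherm (fun x : (Σ j : Fin d, Fin (Mj j) × Fin (Mj j)) => e x + star (e ⟨x.1, x.2.2, x.2.1⟩)) (by
      intro j k l
      simp [add_comm]) (by
      simp only [add_smul, Finset.sum_add_distrib]
      rw [h0, h0', add_zero])
    have r2 := hherm (fun x : (Σ j : Fin d, Fin (Mj j) × Fin (Mj j)) => Complex.I * (e x - star (e ⟨x.1, x.2.2, x.2.1⟩))) (by
      intro j k l
      simp
      ring) (by
      simp only [mul_smul, sub_smul, ← Finset.smul_sum, Finset.sum_sub_distrib]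
      rw [h0, h0', sub_zero, smul_zero])
    intro x
    have a1 := r1 x
    have a2 := r2 x
    simp only [mul_eq_zero, Complex.I_ne_zero, false_or] at a2
    linear_combination (a1 + a2) / 2
  · intro hXli
    rw [Fintype.linearIndependent_iff] at hXli
    have hG0 : ∀ G : Matrix (Σ j : Fin d, Fin (Mj j)) (Σ j : Fin d, Fin (Mj j)) ℂ,
        (∀ p q, m p ≠ m q → G p q = 0) → TT (WW v) (EE m G) 1 = 0 → G = 0 := by
      intro G hG hz
      have hb := hbd G hG
      generalize hx : (fun x : (Σ j : Fin d, Fin (Mj j) × Fin (Mj j)) =>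
        G ⟨x.1, x.2.1⟩ ⟨x.1, x.2.2⟩) = e at hb
      rw [hb, hT1] at hz
      have h3 : ∀ x, e x = 0 := hXli e hz
      rw [← hx] at h3
      ext ⟨j, k⟩ ⟨j', l⟩
      by_cases h : j = j'
      · subst h
        exact h3 ⟨j, k, l⟩
      · exact hG _ _ (fun h' => h (hmono.injective h'))
    have key : ∀ Ψ₁ Ψ₂ : Mat N →ₗ[ℂ] Mat N,
        IsCP Ψ₁ → IsDsSelfAdjoint σ hσ s Ψ₁ → Ψ₁ 1 = 1 → IsCP Ψ₂ →
        ∀ t : ℝ, 0 < t → t < 1 →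
          Φ = (t : ℂ) • Ψ₁ + ((1 - t : ℝ) : ℂ) • Ψ₂ → Ψ₁ = Φ := by
      intro Ψ₁ Ψ₂ h₁ hsa hu h₂ t ht ht1 he
      obtain ⟨g, hg, rfl⟩ := form_of_dominated σ hσ v m hm hE hlin s hs' Φ Ψ₁ Ψ₂ hΦT h₁ hsa h₂
        t ht ht1 he
      have hg2 : ∀ p q, m p ≠ m q → (g - 1) p q = 0 := by
        intro p q h
        have : p ≠ q := fun h' => h (by rw [h'])
        simp [hg p q h, this]
      have hz : TT (WW v) (EE m (g - 1)) 1 = 0 := by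
        have e : EE m (g - 1) = EE m g - EE m 1 := by
          rw [eq_sub_iff_add_eq, ← EE_add, sub_add_cancel]
        rw [e, TT_sub, LinearMap.sub_apply, hu, ← hΦT, hΦu, sub_self]
      have h4 : g - 1 = 0 := hG0 _ hg2 hz
      rw [sub_eq_zero.mp h4, hΦT]
    intro Ψ₁ Ψ₂ h₁ hsa₁ hu₁ h₂ hsa₂ hu₂ t ht ht1 he
    refine ⟨key Ψ₁ Ψ₂ h₁ hsa₁ hu₁ h₂ t ht ht1 he,
      key Ψ₂ Ψ₁ h₂ hsa₂ hu₂ h₁ (1 - t) (by linarith) (by linarith) ?_⟩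
    rw [he, sub_sub_cancel, add_comm]
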